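/- arXiv:1408.1460 — 3 statements merged into one kernel-verified Lean document; each statement's English description precedes it below -/
import Mathlib

section
/- For every natural number N and every real θ, the (N+1)×(N+1) complex matrix B_N(θ) with entries B_N(θ)_{k,m} = √(k!·(N−k)!/(m!·(N−m)!)) · Σ_i binomial(m,i)·binomial(N−m, k−i)·(cos θ)^i·(sin θ)^{m−i}·(sin θ)^{k−i}·(−cos θ)^{(N−m)−(k−i)} (the sum ranging over all integers i with 0 ≤ i ≤ m and 0 ≤ k−i ≤ N−m) is unitary, i.e. B_N(θ) is a member of the unitary group of (N+1)×(N+1) complex matrices. -/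
open Matrix Nat

/-- The beam-splitter transformation matrix on the `N`-photon two-mode subspace,
in the number-state basis `|k, N−k⟩`, `k = 0,…,N`:
`B_N(θ)_{k,m} = √(k!·(N−k)!/(m!·(N−m)!)) · Σ_i C(m,i)·C(N−m,k−i)·(cos θ)^i·(sin θ)^{m−i}·(sin θ)^{k−i}·(−cos θ)^{(N−m)−(k−i)}`,
the sum ranging over integers `i` with `0 ≤ i ≤ m` and `0 ≤ k−i ≤ N−m`. -/
noncomputable def bsFockMatrix (N : ℕ) (θ : ℝ) :
    Matrix (Fin (N + 1)) (Fin (N + 1)) ℂ :=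
  fun k m =>
    ((Real.sqrt ((k.1)! * (N - k.1)! / ((m.1)! * (N - m.1)!)) *
        ∑ i ∈ Finset.range (N + 1),
          if i ≤ m.1 ∧ i ≤ k.1 ∧ k.1 - i ≤ N - m.1 then
            (m.1.choose i : ℝ) * ((N - m.1).choose (k.1 - i) : ℝ) *
              Real.cos θ ^ i * Real.sin θ ^ (m.1 - i) *
              Real.sin θ ^ (k.1 - i) * (-Real.cos θ) ^ ((N - m.1) - (k.1 - i))
          else 0 : ℝ) : ℂ)

/-- The coefficient of `a ^ k * b ^ (N - k)` in `(c a + s b) ^ m * (s a - c b) ^ (N - m)`. -/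
noncomputable def bsCoeff (N : ℕ) (c s : ℝ) (k m : ℕ) : ℝ :=
  ∑ i ∈ Finset.range (N + 1),
    if i ≤ m ∧ i ≤ k ∧ k - i ≤ N - m then
      (m.choose i : ℝ) * ((N - m).choose (k - i) : ℝ) *
        c ^ i * s ^ (m - i) * s ^ (k - i) * (-c) ^ ((N - m) - (k - i))
    else 0

theorem bsFockMatrix_apply (N : ℕ) (θ : ℝ) (k m : Fin (N + 1)) :
    bsFockMatrix N θ k m =
      ((Real.sqrt ((k.1)! * (N - k.1)! / ((m.1)! * (N - m.1)!)) *
        bsCoeff N (Real.cos θ) (Real.sin θ) k m : ℝ) : ℂ) := rfl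

theorem bsCoeff_eq_sum_filter {N k m : ℕ} (c s : ℝ) (hm : m ≤ N) :
    bsCoeff N c s k m =
      ∑ x ∈ (Finset.range (m + 1) ×ˢ Finset.range (N - m + 1)).filter (fun x => x.1 + x.2 = k),
        (m.choose x.1 : ℝ) * ((N - m).choose x.2 : ℝ) *
          c ^ x.1 * s ^ (m - x.1) * s ^ x.2 * (-c) ^ ((N - m) - x.2) := by
  rw [bsCoeff, ← Finset.sum_filter]
  refine Finset.sum_nbij' (fun i => (i, k - i)) (fun x => x.1) ?_ ?_ ?_ ?_ ?_
  · intro i hi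
    simp only [Finset.mem_filter, Finset.mem_range, Finset.mem_product] at hi ⊢
    omega
  · rintro ⟨i, j⟩ hi
    simp only [Finset.mem_filter, Finset.mem_range, Finset.mem_product] at hi ⊢
    omega
  · intro i _
    rfl
  · rintro ⟨i, j⟩ hi
    simp only [Finset.mem_filter, Finset.mem_range, Finset.mem_product, Prod.mk.injEq, true_and] at hi ⊢
    omega
  · intro i _
    rfl

/-- Expansion of the transformed monomial in the monomials `a ^ k * b ^ (N - k)`. -/
theorem sum_bsCoeff_smul_pow_mul_pow {R : Type*} [CommRing R] [Algebra ℝ R] {N m : ℕ}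
    (c s : ℝ) (hm : m ≤ N) (a b : R) :
    ∑ k ∈ Finset.range (N + 1), bsCoeff N c s k m • (a ^ k * b ^ (N - k)) =
      (c • a + s • b) ^ m * (s • a - c • b) ^ (N - m) := by
  have hmaps : ∀ x ∈ Finset.range (m + 1) ×ˢ Finset.range (N - m + 1),
      x.1 + x.2 ∈ Finset.range (N + 1) := by
    intro x hx
    simp only [Finset.mem_range, Finset.mem_product] at hx ⊢
    omega
  have hsub : s • a - c • b = s • a + (-c) • b := by rw [neg_smul, sub_eq_add_neg]
  rw [hsub, add_pow, add_pow, Finset.sum_mul_sum, ← Finset.sum_product',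
    ← Finset.sum_fiberwise_of_maps_to hmaps]
  refine Finset.sum_congr rfl fun k _ => ?_
  rw [bsCoeff_eq_sum_filter c s hm, Finset.sum_smul]
  refine Finset.sum_congr rfl ?_
  rintro ⟨i, j⟩ hx
  simp only [Finset.mem_filter, Finset.mem_range, Finset.mem_product] at hx
  obtain ⟨⟨hi, hj⟩, rfl⟩ := hx
  have hexp : N - (i + j) = (m - i) + (N - m - j) := by omega
  simp only [hexp, Algebra.smul_def, map_mul, map_pow, map_natCast]
  ring

open Polynomial in
theorem sum_bsCoeff_mul_bsCoeff {N k m : ℕ} {c s : ℝ} (hcs : c ^ 2 + s ^ 2 = 1)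
    (hk : k ≤ N) (hm : m ≤ N) :
    ∑ j ∈ Finset.range (N + 1), bsCoeff N c s k j * bsCoeff N c s j m =
      if k = m then 1 else 0 := by
  have hcoeff : ∀ j ≤ N, bsCoeff N c s k j =
      ((c • (X : ℝ[X]) + s • 1) ^ j * (s • (X : ℝ[X]) - c • 1) ^ (N - j)).coeff k := by
    intro j hj
    rw [← sum_bsCoeff_smul_pow_mul_pow c s hj, finsetSum_coeff]
    simp [coeff_X_pow, hk]
  have hcs' : (C c : ℝ[X]) ^ 2 + C s ^ 2 = 1 := by
    rw [← C_pow, ← C_pow, ← C_add, hcs, C_1]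
  have hinv := sum_bsCoeff_smul_pow_mul_pow c s hm
    (c • (X : ℝ[X]) + s • 1) (s • (X : ℝ[X]) - c • 1)
  have h1 : c • (c • (X : ℝ[X]) + s • 1) + s • (s • (X : ℝ[X]) - c • 1) = X := by
    simp only [smul_eq_C_mul]
    linear_combination X * hcs'
  have h2 : s • (c • (X : ℝ[X]) + s • 1) - c • (s • (X : ℝ[X]) - c • 1) = 1 := by
    simp only [smul_eq_C_mul]
    linear_combination hcs'
  rw [h1, h2, one_pow, mul_one] at hinv
  have := congrArg (fun p => p.coeff k) hinv
  simp only [finsetSum_coeff, coeff_smul, coeff_X_pow, smul_eq_mul] at this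
  rw [← this]
  refine Finset.sum_congr rfl fun j hj => ?_
  rw [hcoeff j (Nat.lt_succ_iff.mp (Finset.mem_range.mp hj)), mul_comm]

theorem factorial_mul_bsCoeff_comm {N k m : ℕ} (c s : ℝ) (hk : k ≤ N) (hm : m ≤ N) :
    ((k ! * (N - k)! : ℕ) : ℝ) * bsCoeff N c s k m =
      ((m ! * (N - m)! : ℕ) : ℝ) * bsCoeff N c s m k := by
  rw [bsCoeff, bsCoeff, Finset.mul_sum, Finset.mul_sum]
  refine Finset.sum_congr rfl fun i _ => ?_
  by_cases h : i ≤ m ∧ i ≤ k ∧ k - i ≤ N - m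
  · have h' : i ≤ k ∧ i ≤ m ∧ m - i ≤ N - k := by omega
    rw [if_pos h, if_pos h']
    have e : N - m - (k - i) = N - k - (m - i) := by omega
    have h1 := Nat.choose_mul_factorial_mul_factorial h.1
    have h2 := Nat.choose_mul_factorial_mul_factorial h.2.2
    have h3 := Nat.choose_mul_factorial_mul_factorial h'.1
    have h4 := Nat.choose_mul_factorial_mul_factorial h'.2.2
    rw [e] at h2 ⊢
    have key : k ! * (N - k)! * (m.choose i * (N - m).choose (k - i)) =
        m ! * (N - m)! * (k.choose i * (N - k).choose (m - i)) := by
      rw [← h1, ← h2, ← h3, ← h4]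
      ring
    have key' : ((k ! * (N - k)! : ℕ) : ℝ) * (m.choose i * (N - m).choose (k - i)) =
        ((m ! * (N - m)! : ℕ) : ℝ) * (k.choose i * (N - k).choose (m - i)) := by
      exact_mod_cast key
    linear_combination (c ^ i * s ^ (m - i) * s ^ (k - i) * (-c) ^ (N - k - (m - i))) * key'
  · have h' : ¬ (i ≤ k ∧ i ≤ m ∧ m - i ≤ N - k) := by omega
    rw [if_neg h, if_neg h', mul_zero, mul_zero]

theorem bsFockMatrix_comm (N : ℕ) (θ : ℝ) (k m : Fin (N + 1)) :
    bsFockMatrix N θ k m = bsFockMatrix N θ m k := by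
  have h := factorial_mul_bsCoeff_comm (Real.cos θ) (Real.sin θ)
    (Nat.lt_succ_iff.mp k.2) (Nat.lt_succ_iff.mp m.2)
  push_cast at h
  have hk : (0 : ℝ) < (k.1)! * (N - k.1)! := by positivity
  have hm : (0 : ℝ) < (m.1)! * (N - m.1)! := by positivity
  rw [bsFockMatrix_apply, bsFockMatrix_apply, Real.sqrt_div hk.le, Real.sqrt_div hm.le,
    div_mul_eq_mul_div, div_mul_eq_mul_div]
  congr 1
  rw [div_eq_div_iff (Real.sqrt_pos.2 hm).ne' (Real.sqrt_pos.2 hk).ne']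
  linear_combination h + bsCoeff N (Real.cos θ) (Real.sin θ) k m * Real.mul_self_sqrt hk.le -
    bsCoeff N (Real.cos θ) (Real.sin θ) m k * Real.mul_self_sqrt hm.le

theorem bsFockMatrix_mul_self (N : ℕ) (θ : ℝ) :
    bsFockMatrix N θ * bsFockMatrix N θ = 1 := by
  ext k m
  have h := sum_bsCoeff_mul_bsCoeff (Real.cos_sq_add_sin_sq θ)
    (Nat.lt_succ_iff.mp k.2) (Nat.lt_succ_iff.mp m.2)
  rw [Finset.sum_range] at h
  have hterm : ∀ j : Fin (N + 1), bsFockMatrix N θ k j * bsFockMatrix N θ j m =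
      ((Real.sqrt ((k.1)! * (N - k.1)! / ((m.1)! * (N - m.1)!)) *
        (bsCoeff N (Real.cos θ) (Real.sin θ) k j *
          bsCoeff N (Real.cos θ) (Real.sin θ) j m) : ℝ) : ℂ) := by
    intro j
    have hj : (0 : ℝ) < (j.1)! * (N - j.1)! := by positivity
    rw [bsFockMatrix_apply, bsFockMatrix_apply, ← Complex.ofReal_mul, mul_mul_mul_comm,
      ← Real.sqrt_mul (by positivity), div_mul_div_cancel₀ hj.ne']
  rw [Matrix.mul_apply, Finset.sum_congr rfl fun j _ => hterm j, ← Complex.ofReal_sum,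
    ← Finset.mul_sum, h, Matrix.one_apply]
  by_cases hkm : k = m
  · subst hkm
    have hk : (0 : ℝ) < (k.1)! * (N - k.1)! := by positivity
    simp [div_self hk.ne']
  · simp [hkm, Fin.val_inj]

theorem bsFockMatrix_conjTranspose (N : ℕ) (θ : ℝ) :
    (bsFockMatrix N θ)ᴴ = bsFockMatrix N θ := by
  ext k m
  rw [Matrix.conjTranspose_apply, bsFockMatrix_comm, bsFockMatrix_apply]
  exact Complex.conj_ofReal _

/-- The beam-splitter matrix `B_N(θ)` on the `N`-photon subspace is unitary. -/
theorem bsFockMatrix_unitary (N : ℕ) (θ : ℝ) :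
    bsFockMatrix N θ ∈ Matrix.unitaryGroup (Fin (N + 1)) ℂ := by
  rw [Matrix.mem_unitaryGroup_iff, Matrix.star_eq_conjTranspose, bsFockMatrix_conjTranspose,
    bsFockMatrix_mul_self]
end

section
/- Let m and n be finite types, let A : Matrix (m × n) (m × n) ℂ, let ι be a finite type, and let M : ι → Matrix m m ℂ be a family of matrices satisfying the completeness condition Σ_{k : ι} (M k)ᴴ * (M k) = 1. Then ptr₁(Σ_{k : ι} (M k ⊗ₖ 1) * A * (M k ⊗ₖ 1)ᴴ) = ptr₁(A): any quantum operation given by Kraus operators acting only on the first subsystem leaves the reduced density matrix of the second subsystem unchanged. (This uniformly captures the external state independence lemmas for values, expressions and internal process transitions: whatever operation—unitary transformation or measurement—a process performs on the quantum subsystem it owns, the reduced density matrix of the qubits and number states it does not own is unaffected.) -/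
open Matrix Kronecker

/-- Partial trace over the first factor. -/
noncomputable def ptr₁ {m n : Type*} [Fintype m]
    (A : Matrix (m × n) (m × n) ℂ) : Matrix n n ℂ :=
  fun j j' => ∑ i : m, A (i, j) (i, j')

theorem ptr₁_sum {m n ι : Type*} [Fintype m] (s : Finset ι)
    (B : ι → Matrix (m × n) (m × n) ℂ) : ptr₁ (∑ k ∈ s, B k) = ∑ k ∈ s, ptr₁ (B k) := by
  ext j j'
  simp only [ptr₁, Matrix.sum_apply]
  exact Finset.sum_comm

/-- The partial trace is cyclic for operators acting only on the traced-out factor. -/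
theorem ptr₁_kronecker_one_mul_comm {m n : Type*} [Fintype m] [Fintype n] [DecidableEq n]
    (U : Matrix m m ℂ) (A : Matrix (m × n) (m × n) ℂ) :
    ptr₁ ((U ⊗ₖ (1 : Matrix n n ℂ)) * A) = ptr₁ (A * (U ⊗ₖ (1 : Matrix n n ℂ))) := by
  ext j j'
  simp only [ptr₁, Matrix.mul_apply, Fintype.sum_prod_type, kroneckerMap_apply, Matrix.one_apply,
    mul_ite, mul_one, mul_zero, ite_mul, zero_mul, Finset.sum_ite_eq, Finset.sum_ite_eq',
    Finset.mem_univ, if_true]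
  rw [Finset.sum_comm]
  simp only [mul_comm]

/-- Any quantum operation given by Kraus operators acting only on the first
subsystem leaves the reduced density matrix of the second subsystem unchanged. -/
theorem ptr₁_kraus {m n ι : Type*} [Fintype m] [Fintype n] [Fintype ι]
    [DecidableEq m] [DecidableEq n] (A : Matrix (m × n) (m × n) ℂ)
    (M : ι → Matrix m m ℂ) (hM : ∑ k : ι, (M k)ᴴ * M k = 1) :
    ptr₁ (∑ k : ι, (M k ⊗ₖ (1 : Matrix n n ℂ)) * A * (M k ⊗ₖ (1 : Matrix n n ℂ))ᴴ)
      = ptr₁ A := by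
  have hcomplete : ∑ k : ι, (M k ⊗ₖ (1 : Matrix n n ℂ))ᴴ * (M k ⊗ₖ (1 : Matrix n n ℂ)) = 1 := by
    simp only [conjTranspose_kronecker, conjTranspose_one, ← mul_kronecker_mul, mul_one]
    rw [← one_kronecker_one, ← hM]
    ext ⟨i, j⟩ ⟨i', j'⟩
    simp only [Matrix.sum_apply, kroneckerMap_apply, Finset.sum_mul]
  simp only [ptr₁_sum, Matrix.mul_assoc, ptr₁_kronecker_one_mul_comm]
  rw [← ptr₁_sum, ← Matrix.mul_sum, hcomplete, Matrix.mul_one]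
end

section
/- Let m and n be finite types and let A, B : Matrix (m × n) (m × n) ℂ satisfy ptr₂(A) = ptr₂(B), i.e. the two states have equal reduced density matrices on the first subsystem. Then for every finite type ι and every family M : ι → Matrix n n ℂ with Σ_{k : ι} (M k)ᴴ * (M k) = 1, we have ptr₂(Σ_{k : ι} (1 ⊗ₖ M k) * A * (1 ⊗ₖ M k)ᴴ) = ptr₂(Σ_{k : ι} (1 ⊗ₖ M k) * B * (1 ⊗ₖ M k)ᴴ): equality of the reduced density matrices on the first subsystem is preserved under any quantum operation applied to the second subsystem. (This is the quantum-state content of the independence-of-context-transitions lemma: the action of a context on the quantum state it owns is independent of, and preserves the indistinguishability of, the quantum subsystems owned by the process and the environment.) -/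
open Matrix Kronecker

/-- Partial trace over the second factor. -/
noncomputable def ptr₂ {m n : Type*} [Fintype n]
    (A : Matrix (m × n) (m × n) ℂ) : Matrix m m ℂ :=
  fun i i' => ∑ j : n, A (i, j) (i', j)

/-- The `(i, i')` entry of the partial trace is the trace of the `(i, i')` block. -/
theorem ptr₂_apply_eq_trace {m n : Type*} [Fintype n]
    (A : Matrix (m × n) (m × n) ℂ) (i i' : m) :
    ptr₂ A i i' = (A.submatrix (Prod.mk i) (Prod.mk i')).trace := rfl

theorem submatrix_one_kronecker_conj {m n : Type*} [Fintype m] [Fintype n] [DecidableEq m]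
    (A : Matrix (m × n) (m × n) ℂ) (K L : Matrix n n ℂ) (i i' : m) :
    (((1 : Matrix m m ℂ) ⊗ₖ K) * A * ((1 : Matrix m m ℂ) ⊗ₖ L)ᴴ).submatrix
        (Prod.mk i) (Prod.mk i')
      = K * A.submatrix (Prod.mk i) (Prod.mk i') * Lᴴ := by
  ext j j'
  simp [Matrix.mul_apply, Fintype.sum_prod_type, Matrix.one_apply,
    apply_ite, ite_mul]

theorem ptr₂_sum {m n ι : Type*} [Fintype n] [Fintype ι]
    (F : ι → Matrix (m × n) (m × n) ℂ) : ptr₂ (∑ k, F k) = ∑ k, ptr₂ (F k) := by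
  ext i i'
  simp only [ptr₂, Matrix.sum_apply]
  exact Finset.sum_comm

/-- A trace-preserving operation on the second factor leaves the partial trace unchanged. -/
theorem ptr₂_kraus_snd {m n ι : Type*} [Fintype m] [Fintype n] [DecidableEq m] [DecidableEq n]
    [Fintype ι] (A : Matrix (m × n) (m × n) ℂ) (M : ι → Matrix n n ℂ)
    (hM : ∑ k : ι, (M k)ᴴ * M k = 1) :
    ptr₂ (∑ k : ι, ((1 : Matrix m m ℂ) ⊗ₖ M k) * A * ((1 : Matrix m m ℂ) ⊗ₖ M k)ᴴ)
      = ptr₂ A := by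
  ext i i'
  rw [ptr₂_sum, Matrix.sum_apply]
  simp only [ptr₂_apply_eq_trace, submatrix_one_kronecker_conj]
  simp_rw [Matrix.trace_mul_cycle (M _)]
  rw [← Matrix.trace_sum, ← Finset.sum_mul, hM, one_mul]

/-- Equality of the reduced density matrices on the first subsystem is preserved
under any quantum operation (given by Kraus operators) applied to the second
subsystem. -/
theorem ptr₂_eq_of_kraus_snd {m n : Type*} [Fintype m] [Fintype n]
    [DecidableEq m] [DecidableEq n]
    (A B : Matrix (m × n) (m × n) ℂ) (hAB : ptr₂ A = ptr₂ B)
    {ι : Type*} [Fintype ι] (M : ι → Matrix n n ℂ)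
    (hM : ∑ k : ι, (M k)ᴴ * M k = 1) :
    ptr₂ (∑ k : ι, ((1 : Matrix m m ℂ) ⊗ₖ M k) * A * ((1 : Matrix m m ℂ) ⊗ₖ M k)ᴴ)
      = ptr₂ (∑ k : ι, ((1 : Matrix m m ℂ) ⊗ₖ M k) * B * ((1 : Matrix m m ℂ) ⊗ₖ M k)ᴴ) := by
  rw [ptr₂_kraus_snd A M hM, ptr₂_kraus_snd B M hM, hAB]
end
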